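/- arXiv:2310.10494 — 3 statements merged into one kernel-verified Lean document; each statement's English description precedes it below -/
import Mathlib

section
/- Split conformal coverage guarantee for the MSOMDR prediction region (Proposition 1): Let 𝒰 be a measurable space, K ≥ 1, n ≥ 1, and α ∈ (0,1). Let m̂ : 𝒰 → ℝ^K be a measurable function (the fitted regression function, trained on independent data) and let ŝ ∈ ℝ^K have strictly positive coordinates (the fitted modulation vector). Let (U_1,V_1),…,(U_n,V_n),(U_{n+1},V_{n+1}) be an exchangeable finite sequence of random elements of 𝒰 × ℝ^K, where (U_1,V_1),…,(U_n,V_n) is the calibration sample and (U_{n+1},V_{n+1}) is the new observation. Define the nonconformity scores R_i = max_{1≤k≤K} |V_{i,k} − m̂_k(U_i)| / ŝ_k for i = 1,…,n+1, let j = ⌈(1−α)(n+1)⌉, and let q̂ be the j-th order statistic of R_1,…,R_n if j ≤ n and q̂ = +∞ otherwise. Then P( V_{n+1,k} ∈ [ m̂_k(U_{n+1}) − q̂·ŝ_k , m̂_k(U_{n+1}) + q̂·ŝ_k ] for every k = 1,…,K ) ≥ 1 − α. -/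
open MeasureTheory

/-- The `k`-th smallest value (zero-indexed) of the finite sample `r : Fin n → ℝ`. -/
noncomputable def orderStat {n : ℕ} (r : Fin n → ℝ) (k : Fin n) : ℝ :=
  r (Tuple.sort r k)

lemma aux_count {N : ℕ} (r : Fin N → ℝ) (j : ℕ) (hj : j ≤ N) :
    j ≤ (Finset.univ.filter (fun i : Fin N =>
      (Finset.univ.filter (fun l => r l < r i)).card < j)).card := by
  classical
  have h : ((Finset.univ.filter (fun m : Fin N => m.val < j)).image (Tuple.sort r)) ⊆
      (Finset.univ.filter (fun i : Fin N =>
      (Finset.univ.filter (fun l => r l < r i)).card < j)) := by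
    intro x hx
    simp only [Finset.mem_image, Finset.mem_filter, Finset.mem_univ, true_and] at hx ⊢
    obtain ⟨m, hm, rfl⟩ := hx
    have h2 : (Finset.univ.filter (fun l => r l < r (Tuple.sort r m))) ⊆
        (Finset.Iio m).image (Tuple.sort r) := by
      intro l hl
      simp only [Finset.mem_image, Finset.mem_filter, Finset.mem_univ, true_and,
        Finset.mem_Iio] at hl ⊢
      refine ⟨(Tuple.sort r).symm l, ?_, by simp⟩
      by_contra hc
      have := Tuple.monotone_sort r (not_lt.mp hc)
      simp at this
      linarith
    have h3 := (Finset.card_le_card h2).trans Finset.card_image_le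
    rw [Fin.card_Iio] at h3
    omega
  have h4 := Finset.card_le_card h
  rw [Finset.card_image_of_injective _ (Tuple.sort r).injective] at h4
  have h5 : (Finset.univ.filter (fun m : Fin N => m.val < j)).card = j := by
    rw [Fin.card_filter_val_lt]; omega
  omega

lemma aux_order {n : ℕ} (r : Fin (n + 1) → ℝ) (j : ℕ) (hj1 : 1 ≤ j) (hj : j - 1 < n)
    (h : (Finset.univ.filter (fun l => r l < r (Fin.last n))).card < j) :
    r (Fin.last n) ≤ orderStat (fun i : Fin n => r i.castSucc) ⟨j - 1, hj⟩ := by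
  classical
  by_contra hc
  push Not at hc
  set r' : Fin n → ℝ := fun i => r i.castSucc with hr'
  have hs : (Finset.Iic (⟨j - 1, hj⟩ : Fin n)).image (fun m => (Tuple.sort r' m).castSucc) ⊆
      Finset.univ.filter (fun l => r l < r (Fin.last n)) := by
    intro x hx
    simp only [Finset.mem_image, Finset.mem_filter, Finset.mem_univ, true_and,
      Finset.mem_Iic] at hx ⊢
    obtain ⟨m, hm, rfl⟩ := hx
    exact lt_of_le_of_lt (Tuple.monotone_sort r' hm) hc
  have h1 := Finset.card_le_card hs
  have hinj : Function.Injective (fun m => (Tuple.sort r' m).castSucc) :=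
    (Fin.castSucc_injective n).comp (Tuple.sort r').injective
  rw [Finset.card_image_of_injective _ hinj, Fin.card_Iic] at h1
  simp at h1
  omega

lemma aux_prob {Ω X : Type*} [MeasurableSpace X] [MeasurableSpace Ω] (P : Measure Ω)
    [IsProbabilityMeasure P] (n : ℕ) (W : Fin (n + 1) → Ω → X) (hW : ∀ i, Measurable (W i))
    (hexch : ∀ σ : Equiv.Perm (Fin (n + 1)),
      P.map (fun ω (i : Fin (n + 1)) => W (σ i) ω) =
        P.map (fun ω (i : Fin (n + 1)) => W i ω))
    (f : X → ℝ) (hf : Measurable f) (j : ℕ) (hj : j ≤ n + 1) :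
    (j : ENNReal) ≤ (n + 1) * P {ω | (Finset.univ.filter
      (fun l => f (W l ω) < f (W (Fin.last n) ω))).card < j} := by
  classical
  let A : Fin (n + 1) → Set (Fin (n + 1) → X) := fun i =>
    {w | (Finset.univ.filter (fun l => f (w l) < f (w i))).card < j}
  have hA : ∀ i, MeasurableSet (A i) := by
    intro i
    have : Measurable (fun w : Fin (n + 1) → X =>
        (Finset.univ.filter (fun l => f (w l) < f (w i))).card) := by
      simp only [Finset.card_filter]
      refine Finset.measurable_sum _ fun l _ => ?_
      refine Measurable.ite ?_ measurable_const measurable_const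
      exact measurableSet_lt (hf.comp (measurable_pi_apply l)) (hf.comp (measurable_pi_apply i))
    exact this measurableSet_Iio
  let E : Fin (n + 1) → Set Ω := fun i => {ω | (fun l => W l ω) ∈ A i}
  have hWm : Measurable (fun ω (l : Fin (n + 1)) => W l ω) := measurable_pi_lambda _ hW
  have hE : ∀ i, MeasurableSet (E i) := fun i => hWm (hA i)
  have heq : ∀ i, P (E i) = P (E (Fin.last n)) := by
    intro i
    have h := congrArg (fun μ => μ (A (Fin.last n))) (hexch (Equiv.swap i (Fin.last n)))
    rw [Measure.map_apply (measurable_pi_lambda _ fun l => hW _) (hA _),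
      Measure.map_apply hWm (hA _)] at h
    refine Eq.trans ?_ h
    congr 1
    ext ω
    simp only [E, A, Set.mem_setOf_eq, Set.mem_preimage, Equiv.swap_apply_right]
    have : (Finset.univ.filter (fun l => f (W l ω) < f (W i ω))).card =
      (Finset.univ.filter (fun l => f (W (Equiv.swap i (Fin.last n) l) ω) < f (W i ω))).card := by
      refine Finset.card_equiv (Equiv.swap i (Fin.last n)) ?_
      intro l
      simp
    rw [this]
  have hsum : ∑ i, P (E i) = (n + 1) * P (E (Fin.last n)) := by
    simp [heq]
  change _ ≤ _ * P (E (Fin.last n))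
  rw [← hsum]
  calc (j : ENNReal) = ∫⁻ _, (j : ENNReal) ∂P := by simp
    _ ≤ ∫⁻ ω, ∑ i, (E i).indicator 1 ω ∂P := by
      refine lintegral_mono fun ω => ?_
      have h := aux_count (fun l => f (W l ω)) j hj
      have h2 : ∑ i, (E i).indicator (1 : Ω → ENNReal) ω = (((Finset.univ.filter
          (fun i : Fin (n + 1) => (Finset.univ.filter
            (fun l => f (W l ω) < f (W i ω))).card < j)).card : ℕ) : ENNReal) := by
        rw [Finset.card_filter, Nat.cast_sum]
        refine Finset.sum_congr rfl fun i _ => ?_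
        simp [Set.indicator_apply, E, A]
      change _ ≤ ∑ i, (E i).indicator (1 : Ω → ENNReal) ω
      rw [h2]
      exact_mod_cast h
    _ = ∑ i, P (E i) := by
      rw [lintegral_finsetSum _ fun i _ => measurable_one.indicator (hE i)]
      simp [lintegral_indicator_one, hE]

/-- **Split conformal coverage guarantee for the MSOMDR prediction region (Proposition 1).**
Let `𝒰` be a measurable space, `K ≥ 1`, `n ≥ 1`, `α ∈ (0,1)`.  Let `mhat : 𝒰 → ℝᴷ` be a
measurable fitted regression function and `shat ∈ ℝᴷ` a fitted modulation vector with strictly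
positive coordinates.  Let `(U₁,V₁), …, (U_{n+1},V_{n+1})` be an exchangeable finite sequence
of random elements of `𝒰 × ℝᴷ`, the first `n` being the calibration sample and the last one
the new observation.  With nonconformity scores `Rᵢ = maxₖ |V_{i,k} - mhatₖ(Uᵢ)| / shatₖ`,
`j = ⌈(1-α)(n+1)⌉`, and `q̂` the `j`-th order statistic of `R₁, …, R_n` when `j ≤ n`
(`q̂ = +∞`, i.e. the region is everything, otherwise), the hyperrectangular region
`∏ₖ [mhatₖ(U_{n+1}) - q̂·shatₖ, mhatₖ(U_{n+1}) + q̂·shatₖ]` contains `V_{n+1}` with probability at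
least `1 - α`. -/
theorem msomdr_split_conformal_coverage
    {𝒰 : Type*} [MeasurableSpace 𝒰]
    {Ω : Type*} [MeasurableSpace Ω] (P : Measure Ω) [IsProbabilityMeasure P]
    (K n : ℕ) (hK : 1 ≤ K) (hn : 1 ≤ n)
    (α : ℝ) (hα : α ∈ Set.Ioo (0 : ℝ) 1)
    (mhat : 𝒰 → Fin K → ℝ) (hmhat : Measurable mhat)
    (shat : Fin K → ℝ) (hshat : ∀ k, 0 < shat k)
    (W : Fin (n + 1) → Ω → 𝒰 × (Fin K → ℝ)) (hWmeas : ∀ i, Measurable (W i))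
    (hexch : ∀ σ : Equiv.Perm (Fin (n + 1)),
      P.map (fun ω (i : Fin (n + 1)) => W (σ i) ω) =
        P.map (fun ω (i : Fin (n + 1)) => W i ω))
    (R : Fin (n + 1) → Ω → ℝ)
    (hR : ∀ i ω, R i ω = ⨆ k : Fin K, |(W i ω).2 k - mhat (W i ω).1 k| / shat k)
    (j : ℕ) (hj : j = ⌈(1 - α) * (n + 1)⌉₊) :
    ENNReal.ofReal (1 - α) ≤
      P {ω | if hjn : j ≤ n then
          ∀ k : Fin K,
            (W (Fin.last n) ω).2 k ∈
              Set.Icc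
                (mhat (W (Fin.last n) ω).1 k -
                  orderStat (fun i : Fin n => R i.castSucc ω) ⟨j - 1, by omega⟩ * shat k)
                (mhat (W (Fin.last n) ω).1 k +
                  orderStat (fun i : Fin n => R i.castSucc ω) ⟨j - 1, by omega⟩ * shat k)
        else True} := by
  obtain ⟨hα0, hα1⟩ := hα
  have hpos : (0 : ℝ) < (1 - α) * (n + 1) := mul_pos (by linarith) (by positivity)
  have hj1 : 1 ≤ j := by rw [hj]; exact Nat.ceil_pos.mpr hpos
  have hjle : j ≤ n + 1 := by
    rw [hj]
    apply Nat.ceil_le.mpr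
    push_cast
    nlinarith [(Nat.cast_nonneg n : (0 : ℝ) ≤ n)]
  have hjge : (1 - α) * (n + 1) ≤ j := by rw [hj]; exact Nat.le_ceil _
  let f : 𝒰 × (Fin K → ℝ) → ℝ := fun w => ⨆ k : Fin K, |w.2 k - mhat w.1 k| / shat k
  have hf : Measurable f := by
    refine Measurable.iSup fun k => ?_
    have h1 : Measurable fun w : 𝒰 × (Fin K → ℝ) => w.2 k :=
      (measurable_pi_apply k).comp measurable_snd
    have h2 : Measurable fun w : 𝒰 × (Fin K → ℝ) => mhat w.1 k :=
      (measurable_pi_apply k).comp (hmhat.comp measurable_fst)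
    have h3 := h1.sub h2
    exact (continuous_abs.measurable.comp h3).div_const _
  have hRf : ∀ i ω, R i ω = f (W i ω) := hR
  have key := aux_prob P n W hWmeas hexch f hf j hjle
  have hle : ENNReal.ofReal (1 - α) ≤ P {ω | (Finset.univ.filter
      (fun l => f (W l ω) < f (W (Fin.last n) ω))).card < j} := by
    have h1 : ENNReal.ofReal (1 - α) * (n + 1) ≤ j := by
      have := ENNReal.ofReal_le_ofReal hjge
      rw [ENNReal.ofReal_mul (by linarith), ENNReal.ofReal_natCast] at this
      convert this using 2
      rw [ENNReal.ofReal_add (by positivity) (by positivity)]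
      simp
    have h2 := h1.trans key
    rw [mul_comm] at h2
    exact (ENNReal.mul_le_mul_iff_right (by simp) (by finiteness)).mp h2
  refine hle.trans (measure_mono fun ω hω => ?_)
  simp only [Set.mem_setOf_eq] at hω ⊢
  split_ifs with hjn
  · intro k
    have ho := aux_order (fun i => R i ω) j hj1 (by omega) (by simpa only [hRf] using hω)
    set q := orderStat (fun i : Fin n => R i.castSucc ω) ⟨j - 1, by omega⟩ with hq
    have hk : |(W (Fin.last n) ω).2 k - mhat (W (Fin.last n) ω).1 k| / shat k ≤ q := by
      refine le_trans ?_ ho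
      simp only [hR]
      exact le_ciSup (f := fun k =>
        |(W (Fin.last n) ω).2 k - mhat (W (Fin.last n) ω).1 k| / shat k)
        (Set.finite_range _).bddAbove k
    rw [div_le_iff₀ (hshat k)] at hk
    have := abs_le.mp hk
    constructor <;> linarith
end

section
/- Quantile lemma for exchangeable scores: Let n ≥ 1, α ∈ (0,1), and let R_1,…,R_{n+1} be an exchangeable finite sequence of real-valued random variables on a probability space. Set j = ⌈(1−α)(n+1)⌉ and suppose j ≤ n. Let R_{(j)} denote the j-th order statistic of R_1,…,R_n. Then P( R_{n+1} ≤ R_{(j)} ) ≥ 1 − α. -/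
open MeasureTheory

/-- Number of coordinates strictly below coordinate `i`. -/
noncomputable def cntBelow {m : ℕ} (i : Fin m) (x : Fin m → ℝ) : ℕ :=
  (Finset.univ.filter fun k => x k < x i).card

lemma measurable_cntBelow {m : ℕ} (i : Fin m) : Measurable (cntBelow i) := by
  have h : cntBelow i = fun x : Fin m → ℝ => ∑ k, if x k < x i then 1 else 0 := by
    funext x
    exact Finset.card_filter _ _
  rw [h]
  refine Finset.measurable_sum _ fun k _ => ?_
  exact Measurable.ite (measurableSet_lt (measurable_pi_apply k) (measurable_pi_apply i))
    measurable_const measurable_const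

lemma cntBelow_perm {m : ℕ} (σ : Equiv.Perm (Fin m)) (i : Fin m) (x : Fin m → ℝ) :
    cntBelow i (fun k => x (σ k)) = cntBelow (σ i) x := by
  unfold cntBelow
  refine Finset.card_equiv σ ?_
  intro k
  simp

lemma le_card_cntBelow {m : ℕ} (x : Fin m → ℝ) (j : ℕ) (hj : j ≤ m) :
    j ≤ (Finset.univ.filter fun i => cntBelow i x < j).card := by
  have hmono := Tuple.monotone_sort x
  have key : ∀ k : Fin m, cntBelow (Tuple.sort x k) x ≤ k := by
    intro k
    have : (Finset.univ.filter fun l => x l < x (Tuple.sort x k)) ⊆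
        (Finset.Iio k).map (Tuple.sort x).toEmbedding := by
      intro l hl
      simp only [Finset.mem_filter, Finset.mem_univ, true_and] at hl
      simp only [Finset.mem_map_equiv, Finset.mem_Iio]
      by_contra hc
      have := hmono (not_lt.mp hc)
      simp at this
      linarith
    have := Finset.card_le_card this
    simpa [cntBelow] using this
  have h2 : (Finset.univ.map ((Fin.castLEEmb hj).trans (Tuple.sort x).toEmbedding)) ⊆
      (Finset.univ.filter fun i => cntBelow i x < j) := by
    intro l hl
    simp only [Finset.mem_map, Finset.mem_univ, true_and] at hl
    obtain ⟨a, rfl⟩ := hl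
    simp only [Finset.mem_filter, Finset.mem_univ, true_and]
    refine lt_of_le_of_lt (key (Fin.castLE hj a)) ?_
    simp
  simpa using Finset.card_le_card h2

lemma le_orderStat_of_cntBelow {n : ℕ} (x : Fin (n + 1) → ℝ) (k : Fin n)
    (h : cntBelow (Fin.last n) x ≤ k) :
    x (Fin.last n) ≤ orderStat (fun i : Fin n => x i.castSucc) k := by
  by_contra hc
  push Not at hc
  unfold orderStat at hc
  set r : Fin n → ℝ := fun i => x i.castSucc with hr
  have hmono := Tuple.monotone_sort r
  have h2 : (Finset.Iic k).map ((Tuple.sort r).toEmbedding.trans Fin.castSuccEmb) ⊆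
      (Finset.univ.filter fun l => x l < x (Fin.last n)) := by
    intro l hl
    simp only [Finset.mem_map, Finset.mem_Iic] at hl
    obtain ⟨a, ha, rfl⟩ := hl
    simp only [Finset.mem_filter, Finset.mem_univ, true_and]
    exact lt_of_le_of_lt (hmono ha) hc
  have := Finset.card_le_card h2
  simp only [Finset.card_map, Fin.card_Iic] at this
  unfold cntBelow at h
  omega

/-- **Quantile lemma for exchangeable scores.**
Let `n ≥ 1`, `α ∈ (0,1)`, and let `R₁, …, R_{n+1}` be an exchangeable finite sequence of
real-valued random variables.  Set `j = ⌈(1-α)(n+1)⌉` and suppose `j ≤ n`.  Letting `R₍ⱼ₎`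
denote the `j`-th order statistic of `R₁, …, R_n`, we have `P(R_{n+1} ≤ R₍ⱼ₎) ≥ 1 - α`. -/
theorem quantile_lemma_exchangeable
    {Ω : Type*} [MeasurableSpace Ω] (P : Measure Ω) [IsProbabilityMeasure P]
    (n : ℕ) (hn : 1 ≤ n) (α : ℝ) (hα : α ∈ Set.Ioo (0 : ℝ) 1)
    (R : Fin (n + 1) → Ω → ℝ) (hmeas : ∀ i, Measurable (R i))
    (hexch : ∀ σ : Equiv.Perm (Fin (n + 1)),
      P.map (fun ω (i : Fin (n + 1)) => R (σ i) ω) =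
        P.map (fun ω (i : Fin (n + 1)) => R i ω))
    (j : ℕ) (hj : j = ⌈(1 - α) * (n + 1)⌉₊) (hjn : j ≤ n) :
    ENNReal.ofReal (1 - α) ≤
      P {ω | R (Fin.last n) ω ≤
          orderStat (fun i : Fin n => R i.castSucc ω) ⟨j - 1, by omega⟩} := by
  have hn0 : (0 : ℝ) < n + 1 := by positivity
  have hjpos : 0 < j := by
    rw [hj]
    exact Nat.ceil_pos.mpr (mul_pos (by linarith [hα.2]) hn0)
  have hX : Measurable (fun ω (i : Fin (n + 1)) => R i ω) := measurable_pi_lambda _ hmeas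
  have hB : ∀ i : Fin (n + 1), MeasurableSet {x : Fin (n + 1) → ℝ | cntBelow i x < j} :=
    fun i => measurableSet_lt (measurable_cntBelow i) measurable_const
  set A : Fin (n + 1) → Set Ω := fun i => {ω | cntBelow i (fun k => R k ω) < j} with hA
  have hAm : ∀ i, MeasurableSet (A i) := fun i => hX (hB i)
  have hAeq : ∀ i, P (A i) = P (A (Fin.last n)) := by
    intro i
    have h1 := congrArg (fun μ => μ {x : Fin (n + 1) → ℝ | cntBelow (Fin.last n) x < j})
      (hexch (Equiv.swap (Fin.last n) i))
    rw [Measure.map_apply (measurable_pi_lambda _ fun k => hmeas _) (hB _),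
      Measure.map_apply hX (hB _)] at h1
    rw [show A (Fin.last n) = _ from rfl]
    refine Eq.trans ?_ h1
    congr 1
    ext ω
    have := cntBelow_perm (Equiv.swap (Fin.last n) i) (Fin.last n) (fun k => R k ω)
    rw [Equiv.swap_apply_left] at this
    simp only [hA, Set.mem_setOf_eq, Set.mem_preimage]
    rw [this]
  have hsum : (j : ENNReal) ≤ ∑ i, P (A i) := by
    calc (j : ENNReal) = ∫⁻ _, (j : ENNReal) ∂P := by simp
      _ ≤ ∫⁻ ω, ∑ i, (A i).indicator 1 ω ∂P := by
          refine lintegral_mono fun ω => ?_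
          have := le_card_cntBelow (fun k => R k ω) j (by omega)
          rw [Finset.card_filter] at this
          have h2 : (j : ENNReal) ≤ ((∑ i, if cntBelow i (fun k => R k ω) < j then 1 else 0 : ℕ) : ENNReal) := by
            exact_mod_cast this
          refine h2.trans (le_of_eq ?_)
          push_cast
          refine Finset.sum_congr rfl fun i _ => ?_
          simp [Set.indicator_apply, hA]
      _ = ∑ i, P (A i) := by
          rw [lintegral_finsetSum _ fun i _ => measurable_one.indicator (hAm i)]
          refine Finset.sum_congr rfl fun i _ => ?_
          exact lintegral_indicator_one (hAm i)
  have hsub : A (Fin.last n) ⊆ {ω | R (Fin.last n) ω ≤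
      orderStat (fun i : Fin n => R i.castSucc ω) ⟨j - 1, by omega⟩} := by
    intro ω hω
    refine le_orderStat_of_cntBelow (fun k => R k ω) _ ?_
    simp only [hA, Set.mem_setOf_eq] at hω
    simp only
    omega
  refine le_trans ?_ (measure_mono hsub)
  rw [Finset.sum_congr rfl fun i _ => hAeq i] at hsum
  simp only [Finset.sum_const, Finset.card_univ, Fintype.card_fin, nsmul_eq_mul] at hsum
  rw [ENNReal.ofReal_le_iff_le_toReal (measure_ne_top _ _)]
  have h3 := ENNReal.toReal_mono (ENNReal.mul_ne_top (by simp) (measure_ne_top _ _)) hsum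
  rw [ENNReal.toReal_mul, ENNReal.toReal_natCast, ENNReal.toReal_natCast] at h3
  push_cast at h3
  have h4 : (1 - α) * (n + 1) ≤ j := hj ▸ Nat.le_ceil _
  have h5 := h4.trans h3
  rw [mul_comm] at h5
  exact le_of_mul_le_mul_left h5 hn0
end

section
/- Deterministic order-statistic inflation lemma: Let n ≥ 1, let r_1,…,r_{n+1} be real numbers, and let 1 ≤ k ≤ n. Then r_{n+1} is at most the k-th order statistic of r_1,…,r_n if and only if r_{n+1} is at most the k-th order statistic of the enlarged sample r_1,…,r_{n+1}. -/
theorem le_orderStat_iff {n : ℕ} (r : Fin n → ℝ) (k : Fin n) (x : ℝ) :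
    x ≤ orderStat r k ↔ (Finset.univ.filter (fun i => r i < x)).card ≤ (k : ℕ) := by
  have hm : Monotone (r ∘ Tuple.sort r) := Tuple.monotone_sort r
  have hc : (Finset.univ.filter (fun i => r i < x)).card
      = (Finset.univ.filter (fun j => r (Tuple.sort r j) < x)).card := by
    simp only [Finset.card_filter]
    exact (Equiv.sum_comp (Tuple.sort r) (fun i => if r i < x then 1 else 0)).symm
  rw [hc]
  unfold orderStat
  constructor
  · intro h
    rw [← Fin.card_Iio k]
    apply Finset.card_le_card
    intro j hj
    simp only [Finset.mem_filter, Finset.mem_univ, true_and] at hj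
    rw [Finset.mem_Iio]
    by_contra hkj
    have h2 : r (Tuple.sort r k) ≤ r (Tuple.sort r j) := hm (not_lt.mp hkj)
    linarith
  · intro h
    by_contra hx
    have h1 : (Finset.Iic k).card ≤
        (Finset.univ.filter (fun j => r (Tuple.sort r j) < x)).card := by
      apply Finset.card_le_card
      intro j hj
      simp only [Finset.mem_filter, Finset.mem_univ, true_and]
      have h2 : r (Tuple.sort r j) ≤ r (Tuple.sort r k) := hm (Finset.mem_Iic.mp hj)
      linarith
    rw [Fin.card_Iic] at h1
    omega

/-- **Deterministic order-statistic inflation lemma.**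
Let `n ≥ 1`, let `r₁, …, r_{n+1}` be real numbers, and let `1 ≤ k ≤ n`.  Then `r_{n+1}` is at
most the `k`-th order statistic of `r₁, …, r_n` if and only if `r_{n+1}` is at most the `k`-th
order statistic of the enlarged sample `r₁, …, r_{n+1}`. -/
theorem orderStat_inflation (n : ℕ) (hn : 1 ≤ n) (r : Fin (n + 1) → ℝ)
    (k : ℕ) (hk1 : 1 ≤ k) (hkn : k ≤ n) :
    r (Fin.last n) ≤ orderStat (fun i : Fin n => r i.castSucc) ⟨k - 1, by omega⟩ ↔
      r (Fin.last n) ≤ orderStat r ⟨k - 1, by omega⟩ := by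
  rw [le_orderStat_iff, le_orderStat_iff]
  simp only [Finset.card_filter]
  rw [Fin.sum_univ_castSucc (n := n)]
  simp
end
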